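/- The orbit space ℂP⁵/T⁴ of the T⁴-action on ℂP⁵ given by the composition of the second symmetric power T⁴ ⊂ T⁶ with the standard T⁶-action is homeomorphic to the quotient space (Δ₄,₂ × ℂP²)/≈, where (x, c) ≈ (y, c′) if and only if (x, c) = (y, c′), or x = y and x ∈ ∂Δ₄,₂. -/

import Mathlib

/-- Proportionality of nonzero vectors of `ℂ⁶`: the relation defining `ℂP⁵`. -/
def projRel (x y : {w : Fin 6 → ℂ // w ≠ 0}) : Prop :=
  ∃ c : ℂ, c ≠ 0 ∧ (fun k => c * x.1 k) = y.1

/-- `ℂP⁵`, with the quotient topology. -/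
abbrev CP5 := Quot projRel

/-- Proportionality of nonzero vectors of `ℂ³`: the relation defining `ℂP²`. -/
def projRel2 (x y : {w : Fin 3 → ℂ // w ≠ 0}) : Prop :=
  ∃ c : ℂ, c ≠ 0 ∧ (fun k => c * x.1 k) = y.1

/-- `ℂP²`, with the quotient topology. -/
abbrev CP2 := Quot projRel2

/-- The weights of the `T⁴`-action on `ℂP⁵` given by the composition of the second
symmetric power `T⁴ ⊂ T⁶` with the standard `T⁶`-action:
`t·[w] = [t₁t₂w₀ : t₁t₃w₁ : t₁t₄w₂ : t₂t₃w₃ : t₂t₄w₄ : t₃t₄w₅]`. -/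
def torusCoef (t : Fin 4 → ℂ) : Fin 6 → ℂ :=
  ![t 0 * t 1, t 0 * t 2, t 0 * t 3, t 1 * t 2, t 1 * t 3, t 2 * t 3]

/-- Two points of `ℂP⁵` lie in the same orbit of the compact torus
`T⁴ = {t ∈ ℂ⁴ : |tᵢ| = 1}`. -/
def orbitRel (p q : CP5) : Prop :=
  ∃ t : Fin 4 → ℂ, (∀ i, ‖t i‖ = 1) ∧
    ∃ w w' : {w : Fin 6 → ℂ // w ≠ 0},
      Quot.mk projRel w = p ∧ Quot.mk projRel w' = q ∧
      ∀ k : Fin 6, w'.1 k = torusCoef t k * w.1 k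

/-- The hypersimplex (octahedron) `Δ₄,₂ = {x ∈ ℝ⁴ : 0 ≤ xᵢ ≤ 1, Σxᵢ = 2}`. -/
def hypersimplex : Set (Fin 4 → ℝ) :=
  {x | (∀ i, 0 ≤ x i ∧ x i ≤ 1) ∧ x 0 + x 1 + x 2 + x 3 = 2}

/-- The boundary `∂Δ₄,₂`: points of `Δ₄,₂` having some coordinate equal to `0` or `1`. -/
def hypersimplexBoundary : Set (Fin 4 → ℝ) :=
  {x | x ∈ hypersimplex ∧ ∃ i, x i = 0 ∨ x i = 1}

/-- The gluing relation on `Δ₄,₂ × ℂP²`: `(x,c) ≈ (y,c′)` iff `(x,c) = (y,c′)` or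
(`x = y` and `x ∈ ∂Δ₄,₂`). -/
def glueRel (p q : ↥hypersimplex × CP2) : Prop :=
  p = q ∨ (p.1 = q.1 ∧ (p.1 : Fin 4 → ℝ) ∈ hypersimplexBoundary)

namespace CP5Proof

open Complex Topology

lemma homeo_of_embed {X Y E : Type*} [TopologicalSpace X] [TopologicalSpace Y]
    [TopologicalSpace E] [CompactSpace X] [CompactSpace Y] [T2Space E] (f : X → E) (g : Y → E)
    (hf : Continuous f) (hg : Continuous g) (hfi : Function.Injective f)
    (hgi : Function.Injective g) (h : Set.range f = Set.range g) : Nonempty (X ≃ₜ Y) := by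
  have e1 := (hf.isClosedEmbedding hfi).isEmbedding.toHomeomorph
  have e2 := (hg.isClosedEmbedding hgi).isEmbedding.toHomeomorph
  exact ⟨(e1.trans (Homeomorph.setCongr h)).trans e2.symm⟩

/-- squared Euclidean norm on `ℂ⁶` -/
noncomputable def N (w : Fin 6 → ℂ) : ℝ :=
  normSq (w 0) + normSq (w 1) + normSq (w 2) + normSq (w 3) + normSq (w 4) + normSq (w 5)

/-- the moment map -/
noncomputable def mu (w : Fin 6 → ℂ) : Fin 4 → ℝ :=
  ![(normSq (w 0) + normSq (w 1) + normSq (w 2)) / N w,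
    (normSq (w 0) + normSq (w 3) + normSq (w 4)) / N w,
    (normSq (w 1) + normSq (w 3) + normSq (w 5)) / N w,
    (normSq (w 2) + normSq (w 4) + normSq (w 5)) / N w]

/-- the invariant quadrics -/
noncomputable def zz (w : Fin 6 → ℂ) : Fin 3 → ℂ := ![w 0 * w 5, w 1 * w 4, w 2 * w 3]

/-- squared Euclidean norm on `ℂ³` -/
noncomputable def S (c : Fin 3 → ℂ) : ℝ := normSq (c 0) + normSq (c 1) + normSq (c 2)

/-- a function on the octahedron vanishing exactly on the boundary -/
noncomputable def hh (x : Fin 4 → ℝ) : ℝ :=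
  (x 0 * (1 - x 0)) * (x 1 * (1 - x 1)) * (x 2 * (1 - x 2)) * (x 3 * (1 - x 3))

/-- projector onto the line of `c` -/
noncomputable def mat (c : Fin 3 → ℂ) (i j : Fin 3) : ℂ := c i * (starRingEnd ℂ) (c j) / (S c : ℂ)

abbrev E := (Fin 4 → ℝ) × (Fin 3 → Fin 3 → ℂ)

noncomputable def F (w : Fin 6 → ℂ) : E := (mu w, fun i j => (hh (mu w) : ℂ) * mat (zz w) i j)

noncomputable def G (x : Fin 4 → ℝ) (c : Fin 3 → ℂ) : E := (x, fun i j => (hh x : ℂ) * mat c i j)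

lemma N_pos {w : Fin 6 → ℂ} (hw : w ≠ 0) : 0 < N w := by
  obtain ⟨k, hk⟩ := Function.ne_iff.mp hw
  have h : 0 < normSq (w k) := normSq_pos.mpr hk
  have h0 := normSq_nonneg (w 0)
  have h1 := normSq_nonneg (w 1)
  have h2 := normSq_nonneg (w 2)
  have h3 := normSq_nonneg (w 3)
  have h4 := normSq_nonneg (w 4)
  have h5 := normSq_nonneg (w 5)
  unfold N
  fin_cases k <;> simp only [Fin.isValue, Fin.reduceFinMk, Fin.zero_eta, Fin.mk_one] at h <;> linarith

lemma S_pos {c : Fin 3 → ℂ} (hc : c ≠ 0) : 0 < S c := by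
  obtain ⟨k, hk⟩ := Function.ne_iff.mp hc
  have h : 0 < normSq (c k) := normSq_pos.mpr hk
  have h0 := normSq_nonneg (c 0)
  have h1 := normSq_nonneg (c 1)
  have h2 := normSq_nonneg (c 2)
  unfold S
  fin_cases k <;> simp only [Fin.isValue, Fin.reduceFinMk, Fin.zero_eta, Fin.mk_one] at h <;> linarith

lemma normSq_le_S (c : Fin 3 → ℂ) (k : Fin 3) : normSq (c k) ≤ S c := by
  have h0 := normSq_nonneg (c 0)
  have h1 := normSq_nonneg (c 1)
  have h2 := normSq_nonneg (c 2)
  unfold S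
  fin_cases k <;> simp only [Fin.isValue, Fin.reduceFinMk, Fin.zero_eta, Fin.mk_one] <;> linarith

lemma mat_norm_le (c : Fin 3 → ℂ) (i j : Fin 3) : ‖mat c i j‖ ≤ 1 := by
  have hi := normSq_le_S c i
  have hj := normSq_le_S c j
  rw [normSq_eq_norm_sq] at hi hj
  have hS : 0 ≤ S c := le_trans (by positivity) hi
  unfold mat
  rw [norm_div, norm_mul, RCLike.norm_conj, norm_real, Real.norm_of_nonneg hS]
  apply div_le_one_of_le₀ _ hS
  nlinarith [sq_nonneg (‖c i‖ - ‖c j‖)]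

lemma S_smul (τ : ℂ) (c : Fin 3 → ℂ) : S (fun i => τ * c i) = normSq τ * S c := by
  simp only [S, normSq_mul]; ring

lemma mat_smul {τ : ℂ} (hτ : τ ≠ 0) (c : Fin 3 → ℂ) : mat (fun i => τ * c i) = mat c := by
  ext i j
  unfold mat
  rw [S_smul]
  push_cast
  rw [← mul_conj, map_mul]
  have : (starRingEnd ℂ) τ ≠ 0 := by simpa using hτ
  rw [show τ * c i * ((starRingEnd ℂ) τ * (starRingEnd ℂ) (c j))
    = (τ * (starRingEnd ℂ) τ) * (c i * (starRingEnd ℂ) (c j)) by ring]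
  exact mul_div_mul_left _ _ (mul_ne_zero hτ this)

lemma zz_zero_hh {w : Fin 6 → ℂ} (hw : w ≠ 0) (hz : zz w = 0) : hh (mu w) = 0 := by
  have hN := (N_pos hw).ne'
  have h0 : w 0 * w 5 = 0 := congrFun hz 0
  have h1 : w 1 * w 4 = 0 := congrFun hz 1
  have h2 : w 2 * w 3 = 0 := congrFun hz 2
  have q : ∀ i, (mu w i = 0 ∨ mu w i = 1) → hh (mu w) = 0 := by
    intro i hi
    unfold hh
    fin_cases i <;> rcases hi with hi | hi <;>
      simp only [Fin.isValue, Fin.reduceFinMk, Fin.zero_eta, Fin.mk_one] at hi <;> rw [hi] <;> simp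
  rcases mul_eq_zero.mp h0 with a | a <;> rcases mul_eq_zero.mp h1 with b | b <;>
    rcases mul_eq_zero.mp h2 with c | c
  all_goals first
    | (refine q 0 (Or.inl ?_); simp [mu, a, b, c]; done)
    | (refine q 1 (Or.inl ?_); simp [mu, a, b, c]; done)
    | (refine q 2 (Or.inl ?_); simp [mu, a, b, c]; done)
    | (refine q 3 (Or.inl ?_); simp [mu, a, b, c]; done)
    | (refine q 0 (Or.inr ?_); simp only [mu, Matrix.cons_val]; rw [div_eq_one_iff_eq hN]; simp [N, a, b, c]; done)
    | (refine q 1 (Or.inr ?_); simp only [mu, Matrix.cons_val]; rw [div_eq_one_iff_eq hN]; simp [N, a, b, c]; done)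
    | (refine q 2 (Or.inr ?_); simp only [mu, Matrix.cons_val]; rw [div_eq_one_iff_eq hN]; simp [N, a, b, c]; done)
    | (refine q 3 (Or.inr ?_); simp only [mu, Matrix.cons_val]; rw [div_eq_one_iff_eq hN]; simp [N, a, b, c]; done)

lemma N_eq (w : Fin 6 → ℂ) (hw : w ≠ 0) : mu w ∈ hypersimplex := by
  have hN := (N_pos hw)
  have h0 := normSq_nonneg (w 0)
  have h1 := normSq_nonneg (w 1)
  have h2 := normSq_nonneg (w 2)
  have h3 := normSq_nonneg (w 3)
  have h4 := normSq_nonneg (w 4)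
  have h5 := normSq_nonneg (w 5)
  refine ⟨fun i => ?_, ?_⟩
  · fin_cases i <;> simp only [mu, Fin.isValue, Fin.reduceFinMk, Fin.zero_eta, Fin.mk_one,
      Matrix.cons_val] <;> refine ⟨by positivity, div_le_one_of_le₀ ?_ hN.le⟩ <;> unfold N <;> linarith
  · simp only [mu, Matrix.cons_val]
    field_simp
    unfold N
    ring

lemma F_inv (w w' : Fin 6 → ℂ) (s : Fin 6 → ℂ) (r : ℝ) (hr : r ≠ 0)
    (hs : ∀ k, normSq (s k) = r) (h1 : s 1 * s 4 = s 0 * s 5) (h2 : s 2 * s 3 = s 0 * s 5)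
    (hw : ∀ k, w' k = s k * w k) : F w' = F w := by
  have hn : ∀ k, normSq (w' k) = r * normSq (w k) := by
    intro k; rw [hw, normSq_mul, hs]
  have hN : N w' = r * N w := by simp only [N, hn]; ring
  have hmu : mu w' = mu w := by
    unfold mu
    simp only [hN, hn, ← mul_add, mul_div_mul_left _ _ hr]
  have hz : zz w' = fun i => (s 0 * s 5) * zz w i := by
    ext i
    fin_cases i <;> simp only [zz, Fin.isValue, Fin.reduceFinMk, Fin.zero_eta, Fin.mk_one,
      Matrix.cons_val, hw]
    · ring
    · rw [← h1]; ring
    · rw [← h2]; ring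
  have hne : ∀ k, s k ≠ 0 := fun k => by
    rw [← normSq_pos.trans Iff.rfl] 
    have := hs k
    exact lt_of_le_of_ne (normSq_nonneg _) (by rw [this]; exact hr.symm)
  unfold F
  rw [hmu, hz, mat_smul (mul_ne_zero (hne 0) (hne 5))]

lemma continuous_hh : Continuous hh := by unfold hh; fun_prop

lemma continuous_S : Continuous S := by
  unfold S
  have := continuous_normSq
  fun_prop

lemma continuous_zz : Continuous zz := by
  unfold zz
  refine continuous_pi fun i => ?_
  fin_cases i <;> simp <;> fun_prop

lemma continuous_N : Continuous N := by
  unfold N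
  have := continuous_normSq
  fun_prop

lemma continuous_mu : Continuous fun w : {w : Fin 6 → ℂ // w ≠ 0} => mu w.1 := by
  have hN : Continuous fun w : {w : Fin 6 → ℂ // w ≠ 0} => N w.1 :=
    continuous_N.comp continuous_subtype_val
  have hne : ∀ w : {w : Fin 6 → ℂ // w ≠ 0}, N w.1 ≠ 0 := fun w => (N_pos w.2).ne'
  have hc : ∀ k, Continuous fun w : {w : Fin 6 → ℂ // w ≠ 0} => normSq (w.1 k) := fun k =>
    continuous_normSq.comp ((continuous_apply k).comp continuous_subtype_val)
  unfold mu
  refine continuous_pi fun i => ?_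
  fin_cases i <;> simp <;>
    exact Continuous.div (((hc _).add (hc _)).add (hc _)) hN hne

lemma continuousAt_mat {c : Fin 3 → ℂ} (hc : c ≠ 0) (i j : Fin 3) :
    ContinuousAt (fun c => mat c i j) c := by
  unfold mat
  refine ContinuousAt.div ?_ ?_ ?_
  · have := continuous_conj
    fun_prop
  · exact (continuous_ofReal.comp continuous_S).continuousAt
  · exact_mod_cast (S_pos hc).ne'

lemma continuous_F : Continuous fun w : {w : Fin 6 → ℂ // w ≠ 0} => F w.1 := by
  refine continuous_mu.prodMk (continuous_pi fun i => continuous_pi fun j => ?_)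
  rw [continuous_iff_continuousAt]
  intro w
  have hhc : Continuous fun w : {w : Fin 6 → ℂ // w ≠ 0} => hh (mu w.1) :=
    continuous_hh.comp continuous_mu
  have hzc : Continuous fun w : {w : Fin 6 → ℂ // w ≠ 0} => zz w.1 :=
    continuous_zz.comp continuous_subtype_val
  by_cases hz : zz w.1 = 0
  · have h0 := zz_zero_hh w.2 hz
    unfold ContinuousAt
    simp only [h0, ofReal_zero, zero_mul]
    have ht : Filter.Tendsto (fun w : {w : Fin 6 → ℂ // w ≠ 0} => |hh (mu w.1)|) (𝓝 w) (𝓝 0) := by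
      have := hhc.abs.tendsto w
      rwa [h0, abs_zero] at this
    refine squeeze_zero_norm (fun v => ?_) ht
    rw [norm_mul, norm_real, Real.norm_eq_abs]
    exact mul_le_of_le_one_right (abs_nonneg _) (mat_norm_le _ _ _)
  · refine ContinuousAt.mul (continuous_ofReal.comp hhc).continuousAt ?_
    exact ContinuousAt.comp (f := fun w : {w : Fin 6 → ℂ // w ≠ 0} => zz w.1)
      (g := fun c => mat c i j) (continuousAt_mat hz i j) hzc.continuousAt

/-- `F` on the orbit space -/
noncomputable def Fbar : Quot orbitRel → E :=
  Quot.lift (Quot.lift (fun w => F w.1) (by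
    rintro x y ⟨c, hc, h⟩
    refine (F_inv x.1 y.1 (fun _ => c) (normSq c) (normSq_pos.mpr hc).ne' (fun _ => rfl) rfl rfl
      (fun k => (congrFun h k).symm)).symm)) (by
    rintro p q ⟨t, ht, w, w', rfl, rfl, h⟩
    refine (F_inv w.1 w'.1 (torusCoef t) 1 one_ne_zero (fun k => ?_) ?_ ?_ h).symm
    · rw [normSq_eq_norm_sq]
      fin_cases k <;> simp [torusCoef, ht]
    · simp [torusCoef]; ring
    · simp [torusCoef]; ring)

lemma continuous_Fbar : Continuous Fbar :=
  continuous_quot_lift _ (continuous_quot_lift _ continuous_F)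

/-- `G` on the product -/
noncomputable def G1 (p : ↥hypersimplex × CP2) : E :=
  (p.1.1, fun i j => (hh p.1.1 : ℂ) * (Quot.lift (fun c : {w : Fin 3 → ℂ // w ≠ 0} => mat c.1) (by
    rintro x y ⟨c, hc, h⟩
    rw [← h]
    exact (mat_smul hc _).symm) p.2) i j)

lemma continuous_G1 : Continuous G1 := by
  unfold G1
  refine (continuous_subtype_val.comp continuous_fst).prodMk
    (continuous_pi fun i => continuous_pi fun j => ?_)
  refine Continuous.mul ?_ ?_
  · exact continuous_ofReal.comp (continuous_hh.comp (continuous_subtype_val.comp continuous_fst))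
  · have : Continuous (Quot.lift (fun c : {w : Fin 3 → ℂ // w ≠ 0} => mat c.1) (by
      rintro x y ⟨c, hc, h⟩
      rw [← h]
      exact (mat_smul hc _).symm) : CP2 → Fin 3 → Fin 3 → ℂ) := by
      refine continuous_quot_lift _ (continuous_pi fun i => continuous_pi fun j => ?_)
      rw [continuous_iff_continuousAt]
      intro c
      exact ContinuousAt.comp (f := fun w : {w : Fin 3 → ℂ // w ≠ 0} => w.1)
        (g := fun c => mat c i j) (continuousAt_mat c.2 i j) continuous_subtype_val.continuousAt
    exact ((continuous_apply j).comp ((continuous_apply i).comp this)).comp continuous_snd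

lemma hh_zero_iff {x : Fin 4 → ℝ} (hx : x ∈ hypersimplex) :
    hh x = 0 ↔ x ∈ hypersimplexBoundary := by
  have e : ∀ a : ℝ, 1 - a = 0 ↔ a = 1 := fun a => by rw [sub_eq_zero, eq_comm]
  simp only [hh, mul_eq_zero, e, hypersimplexBoundary, Set.mem_ofPred_eq, hx, true_and,
    Fin.exists_fin_succ, Fin.exists_fin_zero]
  simp
  tauto

/-- `G` on the glued product -/
noncomputable def Gbar : Quot glueRel → E :=
  Quot.lift G1 (by
    rintro p q (rfl | ⟨h, hb⟩)
    · rfl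
    · have h0 := (hh_zero_iff p.1.2).mpr hb
      unfold G1
      rw [← h, h0]
      simp)

lemma continuous_Gbar : Continuous Gbar := continuous_quot_lift _ continuous_G1

/-- proportionality from equality of projectors -/
lemma mat_inj {c d : Fin 3 → ℂ} (hc : c ≠ 0) (hd : d ≠ 0) (h : mat c = mat d) :
    ∃ τ : ℂ, τ ≠ 0 ∧ (fun i => τ * c i) = d := by
  obtain ⟨j, hj⟩ := Function.ne_iff.mp hc
  have hSc : (S c : ℂ) ≠ 0 := by exact_mod_cast (S_pos hc).ne'
  have hSd : (S d : ℂ) ≠ 0 := by exact_mod_cast (S_pos hd).ne'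
  have hcj : (starRingEnd ℂ) (c j) ≠ 0 := by simpa using hj
  have e : ∀ i, c i * (starRingEnd ℂ) (c j) * S d = d i * (starRingEnd ℂ) (d j) * S c := by
    intro i
    have := congrFun (congrFun h i) j
    unfold mat at this
    rwa [div_eq_div_iff hSc hSd] at this
  have hdj : (starRingEnd ℂ) (d j) ≠ 0 := by
    intro h0
    have := e j
    rw [h0] at this
    simp only [mul_zero, zero_mul, mul_eq_zero] at this
    rcases this with (h | h) | h
    · exact hj h
    · exact hcj h
    · exact hSd h
  refine ⟨(starRingEnd ℂ) (c j) * S d / ((starRingEnd ℂ) (d j) * S c),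
    div_ne_zero (mul_ne_zero hcj hSd) (mul_ne_zero hdj hSc), ?_⟩
  ext i
  rw [div_mul_eq_mul_div, div_eq_iff (mul_ne_zero hdj hSc)]
  linear_combination e i

lemma Gbar_inj : Function.Injective Gbar := by
  rintro ⟨⟨x, ⟨c⟩⟩⟩ ⟨⟨y, ⟨d⟩⟩⟩ h
  have h1 : x.1 = y.1 := congrArg Prod.fst h
  have h2 : (fun i j => (hh x.1 : ℂ) * mat c.1 i j) = fun i j => (hh y.1 : ℂ) * mat d.1 i j :=
    congrArg Prod.snd h
  obtain rfl := Subtype.ext h1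
  apply Quot.sound
  by_cases h0 : hh x.1 = 0
  · exact Or.inr ⟨rfl, (hh_zero_iff x.2).mp h0⟩
  · left
    have hm : mat c.1 = mat d.1 := by
      ext i j
      have := congrFun (congrFun h2 i) j
      exact mul_left_cancel₀ (by exact_mod_cast h0) this
    obtain ⟨τ, hτ, e⟩ := mat_inj c.2 d.2 hm
    exact congrArg (Prod.mk x) (Quot.sound ⟨τ, hτ, e⟩)

lemma pair_le {a b a' b' : ℝ} (ha' : 0 ≤ a') (hb : 0 ≤ b) (ha : 0 ≤ a) (hb' : 0 ≤ b')
    (hd : a - b = a' - b') (h : a * b ≤ a' * b') : a ≤ a' ∧ b ≤ b' := by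
  have : a ≤ a' := by
    by_contra hlt
    push Not at hlt
    have : b' < b := by linarith
    nlinarith
  exact ⟨this, by linarith⟩

lemma pair_phase {a b a' b' τ : ℂ} (hτ : ‖τ‖ = 1) (ha : ‖a‖ = ‖a'‖) (hb : ‖b‖ = ‖b'‖)
    (h : τ * (a * b) = a' * b') :
    ∃ u v : ℂ, ‖u‖ = 1 ∧ ‖v‖ = 1 ∧ a' = u * a ∧ b' = v * b ∧ u * v = τ := by
  have hτ0 : τ ≠ 0 := by intro h; simp [h] at hτ
  by_cases ha0 : a = 0
  · have ha'0 : a' = 0 := by rw [← norm_eq_zero, ← ha, ha0, norm_zero]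
    by_cases hb0 : b = 0
    · have hb'0 : b' = 0 := by rw [← norm_eq_zero, ← hb, hb0, norm_zero]
      exact ⟨1, τ, by simp, hτ, by simp [ha0, ha'0], by simp [hb0, hb'0], by simp⟩
    · have hb'0 : b' ≠ 0 := by rw [← norm_ne_zero_iff, ← hb]; exact norm_ne_zero_iff.mpr hb0
      refine ⟨τ * b / b', b' / b, ?_, ?_, ?_, ?_, ?_⟩
      · rw [norm_div, norm_mul, hτ, hb, one_mul, div_self (norm_ne_zero_iff.mpr hb'0)]
      · rw [norm_div, hb, div_self (norm_ne_zero_iff.mpr hb'0)]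
      · simp [ha0, ha'0]
      · field_simp
      · field_simp
  · have ha'0 : a' ≠ 0 := by rw [← norm_ne_zero_iff, ← ha]; exact norm_ne_zero_iff.mpr ha0
    refine ⟨a' / a, τ * a / a', ?_, ?_, ?_, ?_, ?_⟩
    · rw [norm_div, ha, div_self (norm_ne_zero_iff.mpr ha'0)]
    · rw [norm_div, norm_mul, hτ, ha, one_mul, div_self (norm_ne_zero_iff.mpr ha'0)]
    · field_simp
    · field_simp
      linear_combination -h
    · field_simp

lemma exists_torus {u : Fin 6 → ℂ} (hu : ∀ k, ‖u k‖ = 1) (h1 : u 1 * u 4 = u 0 * u 5)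
    (h2 : u 2 * u 3 = u 0 * u 5) : ∃ t : Fin 4 → ℂ, (∀ i, ‖t i‖ = 1) ∧ torusCoef t = u := by
  have hne : ∀ k, u k ≠ 0 := fun k h => by have := hu k; simp [h] at this
  obtain ⟨s, hs⟩ := IsAlgClosed.exists_pow_nat_eq (u 0 * u 1 / u 3) (n := 2) (by norm_num)
  have hs1 : ‖s‖ = 1 := by
    have : ‖s‖ ^ 2 = 1 := by rw [← norm_pow, hs]; simp [hu]
    nlinarith [norm_nonneg s]
  have hs0 : s ≠ 0 := by intro h; simp [h] at hs1
  have n0 := hne 0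
  have n1 := hne 1
  have n3 := hne 3
  rw [eq_div_iff n3] at hs
  refine ⟨![s, u 0 / s, u 1 / s, u 2 / s], ?_, ?_⟩
  · intro i
    fin_cases i <;> simp [hs1, hu]
  · ext k
    fin_cases k <;> simp [torusCoef]
    · field_simp
    · field_simp
    · field_simp
    · field_simp
      linear_combination -hs
    · field_simp
      apply mul_right_cancel₀ (mul_ne_zero n1 n3)
      linear_combination (- u 4 * u 1) * hs + (u 0 * u 1) * (h2 - h1)
    · field_simp
      apply mul_right_cancel₀ (mul_ne_zero n0 n3)
      linear_combination (- u 5 * u 0) * hs + (u 0 * u 1) * h2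

lemma exists_rep (p : Quot orbitRel) : ∃ w : {w : Fin 6 → ℂ // w ≠ 0}, N w.1 = 1 ∧
    Quot.mk orbitRel (Quot.mk projRel w) = p := by
  obtain ⟨⟨w⟩⟩ := p
  have hN := N_pos w.2
  have hs : (((Real.sqrt (N w.1))⁻¹ : ℝ) : ℂ) ≠ 0 := by
    exact_mod_cast inv_ne_zero (Real.sqrt_pos.mpr hN).ne'
  set r : ℂ := (((Real.sqrt (N w.1))⁻¹ : ℝ) : ℂ) with hr
  have hw' : (fun k => r * w.1 k) ≠ 0 := by
    intro h
    apply w.2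
    ext k
    have := congrFun h k
    exact (mul_eq_zero.mp this).resolve_left hs
  refine ⟨⟨_, hw'⟩, ?_, ?_⟩
  · have : normSq r = (N w.1)⁻¹ := by
      rw [hr, normSq_ofReal, ← mul_inv, Real.mul_self_sqrt hN.le]
    have e : N (fun k => r * w.1 k) = normSq r * N w.1 := by
      simp only [N, normSq_mul]; ring
    simp only [e, this, inv_mul_cancel₀ hN.ne']
  · exact congrArg _ (Quot.sound ⟨r, hs, rfl⟩).symm

lemma hh_zero_zz {w : Fin 6 → ℂ} (hN : N w = 1) (h : hh (mu w) = 0) : zz w = 0 := by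
  have h0 := normSq_nonneg (w 0)
  have h1 := normSq_nonneg (w 1)
  have h2 := normSq_nonneg (w 2)
  have h3 := normSq_nonneg (w 3)
  have h4 := normSq_nonneg (w 4)
  have h5 := normSq_nonneg (w 5)
  have hN' := hN
  unfold N at hN'
  simp only [hh, mu, Matrix.cons_val, hN, div_one, mul_eq_zero] at h
  have z : ∀ k, normSq (w k) ≤ 0 → w k = 0 := fun k hk =>
    normSq_eq_zero.mp (le_antisymm hk (normSq_nonneg _))
  have fin : ∀ a b c : ℂ, a = 0 → b = 0 → c = 0 → (![a, b, c] : Fin 3 → ℂ) = 0 := by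
    rintro a b c rfl rfl rfl
    ext i; fin_cases i <;> rfl
  unfold zz
  rcases h with ((((h | h) | (h | h)) | (h | h)) | (h | h)) <;> apply fin <;>
    first
    | exact mul_eq_zero_of_left (z _ (by linarith)) _
    | exact mul_eq_zero_of_right _ (z _ (by linarith))

lemma tau_exists {w w' : Fin 6 → ℂ} (hw : w ≠ 0) (hw' : w' ≠ 0) (hN : N w = 1) (hN' : N w' = 1)
    (hF : F w = F w') : mu w = mu w' ∧ ∃ τ : ℂ, ‖τ‖ = 1 ∧ (fun i => τ * zz w i) = zz w' := by
  have hm : mu w = mu w' := congrArg Prod.fst hF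
  refine ⟨hm, ?_⟩
  by_cases h0 : hh (mu w) = 0
  · refine ⟨1, by simp, ?_⟩
    rw [hh_zero_zz hN h0, hh_zero_zz hN' (hm ▸ h0)]
    ext; simp
  have hz : zz w ≠ 0 := fun h => h0 (zz_zero_hh hw h)
  have hz' : zz w' ≠ 0 := fun h => h0 (hm ▸ zz_zero_hh hw' h)
  have hmat : mat (zz w) = mat (zz w') := by
    ext i j
    have : (hh (mu w) : ℂ) * mat (zz w) i j = (hh (mu w') : ℂ) * mat (zz w') i j :=
      congrFun (congrFun (congrArg Prod.snd hF) i) j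
    rw [← hm] at this
    exact mul_left_cancel₀ (by exact_mod_cast h0) this
  obtain ⟨τ, hτ, e⟩ := mat_inj hz hz' hmat
  refine ⟨τ, ?_, e⟩
  have e0 : τ * (w 0 * w 5) = w' 0 * w' 5 := congrFun e 0
  have e1 : τ * (w 1 * w 4) = w' 1 * w' 4 := congrFun e 1
  have e2 : τ * (w 2 * w 3) = w' 2 * w' 3 := congrFun e 2
  replace e0 := congrArg normSq e0
  replace e1 := congrArg normSq e1
  replace e2 := congrArg normSq e2
  simp only [normSq_mul] at e0 e1 e2
  have m0 : mu w 0 = mu w' 0 := by rw [hm]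
  have m1 : mu w 1 = mu w' 1 := by rw [hm]
  have m2 : mu w 2 = mu w' 2 := by rw [hm]
  have m3 : mu w 3 = mu w' 3 := by rw [hm]
  simp only [mu, Matrix.cons_val, hN, hN', div_one] at m0 m1 m2 m3
  have hS := S_pos hz
  simp only [S, zz, Matrix.cons_val, normSq_mul] at hS
  unfold N at hN hN'
  have hρ : normSq τ = 1 := by
    have hp := normSq_nonneg (w 0)
    have hp1 := normSq_nonneg (w 1)
    have hp2 := normSq_nonneg (w 2)
    have hp3 := normSq_nonneg (w 3)
    have hp4 := normSq_nonneg (w 4)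
    have hp5 := normSq_nonneg (w 5)
    have hq := normSq_nonneg (w' 0)
    have hq1 := normSq_nonneg (w' 1)
    have hq2 := normSq_nonneg (w' 2)
    have hq3 := normSq_nonneg (w' 3)
    have hq4 := normSq_nonneg (w' 4)
    have hq5 := normSq_nonneg (w' 5)
    have g0 := mul_nonneg hp hp5
    have g1 := mul_nonneg hp1 hp4
    have g2 := mul_nonneg hp2 hp3
    generalize normSq τ = ρ at *
    generalize normSq (w 0) = p0 at *
    generalize normSq (w 1) = p1 at *
    generalize normSq (w 2) = p2 at *
    generalize normSq (w 3) = p3 at *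
    generalize normSq (w 4) = p4 at *
    generalize normSq (w 5) = p5 at *
    generalize normSq (w' 0) = q0 at *
    generalize normSq (w' 1) = q1 at *
    generalize normSq (w' 2) = q2 at *
    generalize normSq (w' 3) = q3 at *
    generalize normSq (w' 4) = q4 at *
    generalize normSq (w' 5) = q5 at *
    have key : p0 = q0 ∧ p5 = q5 ∧ p1 = q1 ∧ p4 = q4 ∧ p2 = q2 ∧ p3 = q3 := by
      rcases le_total 1 ρ with h | h
      · have a0 := pair_le hq hp5 hp hq5 (by linarith) (by rw [← e0]; nlinarith)
        have a1 := pair_le hq1 hp4 hp1 hq4 (by linarith) (by rw [← e1]; nlinarith)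
        have a2 := pair_le hq2 hp3 hp2 hq3 (by linarith) (by rw [← e2]; nlinarith)
        obtain ⟨_, _⟩ := a0
        obtain ⟨_, _⟩ := a1
        obtain ⟨_, _⟩ := a2
        refine ⟨?_, ?_, ?_, ?_, ?_, ?_⟩ <;> linarith
      · have a0 := pair_le hp hq5 hq hp5 (by linarith) (by rw [← e0]; nlinarith)
        have a1 := pair_le hp1 hq4 hq1 hp4 (by linarith) (by rw [← e1]; nlinarith)
        have a2 := pair_le hp2 hq3 hq2 hp3 (by linarith) (by rw [← e2]; nlinarith)
        obtain ⟨_, _⟩ := a0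
        obtain ⟨_, _⟩ := a1
        obtain ⟨_, _⟩ := a2
        refine ⟨?_, ?_, ?_, ?_, ?_, ?_⟩ <;> linarith
    obtain ⟨rfl, rfl, rfl, rfl, rfl, rfl⟩ := key
    have : (ρ - 1) * (p0 * p5 + p1 * p4 + p2 * p3) = 0 := by linear_combination e0 + e1 + e2
    rcases mul_eq_zero.mp this with h | h
    · linarith
    · linarith
  rw [normSq_eq_norm_sq] at hρ
  nlinarith [norm_nonneg τ]

lemma pair_norm {a b a' b' τ : ℂ} (hτ : ‖τ‖ = 1) (h : τ * (a * b) = a' * b')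
    (hd : normSq a - normSq b = normSq a' - normSq b') : ‖a‖ = ‖a'‖ ∧ ‖b‖ = ‖b'‖ := by
  have e := congrArg normSq h
  simp only [normSq_mul] at e
  rw [normSq_eq_norm_sq τ, hτ] at e
  have h1 := pair_le (normSq_nonneg a') (normSq_nonneg b) (normSq_nonneg a) (normSq_nonneg b') hd
    (by linarith)
  have h2 := pair_le (normSq_nonneg a) (normSq_nonneg b') (normSq_nonneg a') (normSq_nonneg b)
    hd.symm (by linarith)
  have e1 := le_antisymm h1.1 h2.1
  have e2 := le_antisymm h1.2 h2.2
  rw [normSq_eq_norm_sq, normSq_eq_norm_sq] at e1 e2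
  exact ⟨(sq_eq_sq₀ (norm_nonneg _) (norm_nonneg _)).mp e1,
    (sq_eq_sq₀ (norm_nonneg _) (norm_nonneg _)).mp e2⟩

lemma Fbar_inj : Function.Injective Fbar := by
  intro p q h
  obtain ⟨w, hN, rfl⟩ := exists_rep p
  obtain ⟨w', hN', rfl⟩ := exists_rep q
  have hF : F w.1 = F w'.1 := h
  obtain ⟨hm, τ, hτ, e⟩ := tau_exists w.2 w'.2 hN hN' hF
  have e0 : τ * (w.1 0 * w.1 5) = w'.1 0 * w'.1 5 := congrFun e 0
  have e1 : τ * (w.1 1 * w.1 4) = w'.1 1 * w'.1 4 := congrFun e 1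
  have e2 : τ * (w.1 2 * w.1 3) = w'.1 2 * w'.1 3 := congrFun e 2
  have m0 : mu w.1 0 = mu w'.1 0 := by rw [hm]
  have m1 : mu w.1 1 = mu w'.1 1 := by rw [hm]
  have m2 : mu w.1 2 = mu w'.1 2 := by rw [hm]
  have m3 : mu w.1 3 = mu w'.1 3 := by rw [hm]
  simp only [mu, Matrix.cons_val, hN, hN', div_one] at m0 m1 m2 m3
  obtain ⟨a0, a5⟩ := pair_norm hτ e0 (by linarith)
  obtain ⟨a1, a4⟩ := pair_norm hτ e1 (by linarith)
  obtain ⟨a2, a3⟩ := pair_norm hτ e2 (by linarith)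
  obtain ⟨u0, u5, b0, b5, c0, c5, d0⟩ := pair_phase hτ a0 a5 e0
  obtain ⟨u1, u4, b1, b4, c1, c4, d1⟩ := pair_phase hτ a1 a4 e1
  obtain ⟨u2, u3, b2, b3, c2, c3, d2⟩ := pair_phase hτ a2 a3 e2
  obtain ⟨t, ht, htu⟩ := exists_torus (u := ![u0, u1, u2, u3, u4, u5])
    (by intro k; fin_cases k <;> simpa) (by simp [d0, d1]) (by simp [d0, d2])
  apply Quot.sound
  refine ⟨t, ht, w, w', rfl, rfl, ?_⟩
  rw [htu]
  intro k
  fin_cases k <;> simpa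

lemma exists_pair (c : ℂ) (l p q : ℝ) (hl : 0 ≤ l) (hp : 0 ≤ p) (hq : 0 ≤ q)
    (h : p * q = l * normSq c) :
    ∃ a b : ℂ, normSq a = p ∧ normSq b = q ∧ a * b = (Real.sqrt l : ℂ) * c := by
  have hs : Real.sqrt p * Real.sqrt q = Real.sqrt l * ‖c‖ := by
    rw [← Real.sqrt_mul hp, h, Real.sqrt_mul hl, normSq_eq_norm_sq, Real.sqrt_sq (norm_nonneg c)]
  refine ⟨(Real.sqrt p : ℂ), (Real.sqrt q : ℂ) * exp (arg c * I), ?_, ?_, ?_⟩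
  · rw [normSq_ofReal, Real.mul_self_sqrt hp]
  · rw [normSq_mul, normSq_ofReal, Real.mul_self_sqrt hq, normSq_eq_norm_sq,
      norm_exp_ofReal_mul_I]
    ring
  · rw [← mul_assoc, ← ofReal_mul, hs, ofReal_mul, mul_assoc, norm_mul_exp_arg_mul_I]

lemma exists_lift {x : Fin 4 → ℝ} (hx : x ∈ hypersimplex) {c : Fin 3 → ℂ} (hc : c ≠ 0) :
    ∃ w : Fin 6 → ℂ, N w = 1 ∧ mu w = x ∧ ∃ s : ℂ, zz w = fun i => s * c i := by
  obtain ⟨hb, hsum⟩ := hx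
  have hb0 := hb 0
  have hb1 := hb 1
  have hb2 := hb 2
  have hb3 := hb 3
  set d0 := x 0 + x 1 - 1 with hd0
  set d1 := x 0 + x 2 - 1 with hd1
  set d2 := x 0 + x 3 - 1 with hd2
  let φ : ℝ → ℝ := fun l => Real.sqrt (d0 ^ 2 + 4 * l * normSq (c 0)) +
    Real.sqrt (d1 ^ 2 + 4 * l * normSq (c 1)) + Real.sqrt (d2 ^ 2 + 4 * l * normSq (c 2))
  have hφ : Continuous φ := by fun_prop
  have hφ0 : φ 0 ≤ 1 := by
    simp only [φ, mul_zero, zero_mul, add_zero, Real.sqrt_sq_eq_abs]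
    rcases abs_cases d0 with ⟨h0, _⟩ | ⟨h0, _⟩ <;> rcases abs_cases d1 with ⟨h1, _⟩ | ⟨h1, _⟩ <;>
      rcases abs_cases d2 with ⟨h2, _⟩ | ⟨h2, _⟩ <;> rw [h0, h1, h2] <;> linarith
  obtain ⟨L, hL, hφL⟩ : ∃ L, 0 ≤ L ∧ 1 ≤ φ L := by
    obtain ⟨j, hj⟩ := Function.ne_iff.mp hc
    have hj' : 0 < normSq (c j) := normSq_pos.mpr hj
    refine ⟨1 / (4 * normSq (c j)), by positivity, ?_⟩
    have hk : 4 * (1 / (4 * normSq (c j))) * normSq (c j) = 1 := by field_simp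
    have key : ∀ d : ℝ, 1 ≤ Real.sqrt (d ^ 2 + 4 * (1 / (4 * normSq (c j))) * normSq (c j)) := by
      intro d
      rw [hk]
      apply Real.le_sqrt_of_sq_le
      nlinarith [sq_nonneg d]
    have k0 := Real.sqrt_nonneg (d0 ^ 2 + 4 * (1 / (4 * normSq (c j))) * normSq (c 0))
    have k1 := Real.sqrt_nonneg (d1 ^ 2 + 4 * (1 / (4 * normSq (c j))) * normSq (c 1))
    have k2 := Real.sqrt_nonneg (d2 ^ 2 + 4 * (1 / (4 * normSq (c j))) * normSq (c 2))
    have r0 := key d0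
    have r1 := key d1
    have r2 := key d2
    simp only [φ]
    fin_cases j <;> simp only [Fin.isValue, Fin.reduceFinMk, Fin.zero_eta, Fin.mk_one] at * <;>
      linarith
  obtain ⟨l, ⟨hl, _⟩, hφl⟩ := intermediate_value_Icc hL hφ.continuousOn ⟨hφ0, hφL⟩
  have gen : ∀ (d : ℝ) (z : ℂ), ∃ a b : ℂ,
      normSq a = (Real.sqrt (d ^ 2 + 4 * l * normSq z) + d) / 2 ∧
      normSq b = (Real.sqrt (d ^ 2 + 4 * l * normSq z) - d) / 2 ∧
      a * b = (Real.sqrt l : ℂ) * z := by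
    intro d z
    have hz := normSq_nonneg z
    have hnn : 0 ≤ d ^ 2 + 4 * l * normSq z := by positivity
    have hsq := Real.sq_sqrt hnn
    have habs : |d| ≤ Real.sqrt (d ^ 2 + 4 * l * normSq z) := by
      apply Real.le_sqrt_of_sq_le
      rw [sq_abs]
      have : 0 ≤ 4 * l * normSq z := by positivity
      linarith
    have := abs_le.mp habs
    apply exists_pair z l _ _ hl
    · linarith
    · linarith
    · linear_combination hsq / 4
  obtain ⟨a0, a5, h0, h5, p0⟩ := gen d0 (c 0)
  obtain ⟨a1, a4, h1, h4, p1⟩ := gen d1 (c 1)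
  obtain ⟨a2, a3, h2, h3, p2⟩ := gen d2 (c 2)
  have hN : N ![a0, a1, a2, a3, a4, a5] = 1 := by
    simp only [N, Matrix.cons_val, h0, h1, h2, h3, h4, h5]
    simp only [φ] at hφl
    linarith
  refine ⟨![a0, a1, a2, a3, a4, a5], hN, ?_, (Real.sqrt l : ℂ), ?_⟩
  · simp only [φ] at hφl
    ext i
    unfold mu
    fin_cases i <;> simp only [hN, div_one, Fin.isValue, Fin.reduceFinMk, Fin.zero_eta, Fin.mk_one,
      Matrix.cons_val, h0, h1, h2, h3, h4, h5] <;> linarith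
  · ext i
    fin_cases i <;> simp [zz, p0, p1, p2]

lemma range_eq : Set.range Fbar = Set.range Gbar := by
  apply Set.Subset.antisymm
  · rintro _ ⟨⟨⟨w⟩⟩, rfl⟩
    by_cases hz : zz w.1 = 0
    · refine ⟨Quot.mk _ (⟨mu w.1, N_eq _ w.2⟩, Quot.mk _ ⟨fun _ => 1, ?_⟩), ?_⟩
      · intro h; exact one_ne_zero (congrFun h 0)
      · change G (mu w.1) _ = F w.1
        unfold G F
        rw [zz_zero_hh w.2 hz]
        simp
    · exact ⟨Quot.mk _ (⟨mu w.1, N_eq _ w.2⟩, Quot.mk _ ⟨zz w.1, hz⟩), rfl⟩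
  · rintro _ ⟨⟨⟨x, ⟨c⟩⟩⟩, rfl⟩
    obtain ⟨w, hN, hm, s, hs⟩ := exists_lift x.2 c.2
    have hw : w ≠ 0 := by
      rintro rfl
      simp [N] at hN
    refine ⟨Quot.mk _ (Quot.mk _ ⟨w, hw⟩), ?_⟩
    change F w = G x.1 c.1
    unfold F G
    rw [hm]
    by_cases h0 : hh x.1 = 0
    · simp [h0]
    · have hs0 : s ≠ 0 := by
        rintro rfl
        apply h0
        rw [← hm]
        apply zz_zero_hh hw
        rw [hs]
        ext; simp
      rw [hs, mat_smul hs0]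

instance compact_orbit : CompactSpace (Quot orbitRel) := by
  let K : Set (Fin 6 → ℂ) := {w | N w = 1}
  have hK : IsCompact K := by
    refine Metric.isCompact_of_isClosed_isBounded (isClosed_eq continuous_N continuous_const) ?_
    refine Metric.isBounded_closedBall.subset (s := K) (t := Metric.closedBall 0 1) ?_
    intro w hw
    rw [mem_closedBall_zero_iff, pi_norm_le_iff_of_nonneg zero_le_one]
    intro k
    have hw : N w = 1 := hw
    unfold N at hw
    have h0 := normSq_nonneg (w 0)
    have h1 := normSq_nonneg (w 1)
    have h2 := normSq_nonneg (w 2)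
    have h3 := normSq_nonneg (w 3)
    have h4 := normSq_nonneg (w 4)
    have h5 := normSq_nonneg (w 5)
    have : normSq (w k) ≤ 1 := by
      fin_cases k <;> simp only [Fin.isValue, Fin.reduceFinMk, Fin.zero_eta, Fin.mk_one] <;>
        linarith
    rw [normSq_eq_norm_sq] at this
    nlinarith [norm_nonneg (w k)]
  have : CompactSpace K := isCompact_iff_compactSpace.mp hK
  have hne : ∀ w : K, w.1 ≠ 0 := by
    rintro ⟨w, hw⟩ h
    have hw : N w = 1 := hw
    simp only at h
    rw [h] at hw
    simp [N] at hw
  let f : K → Quot orbitRel := fun w => Quot.mk _ (Quot.mk _ ⟨w.1, hne w⟩)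
  have hf : Continuous f := continuous_quot_mk.comp (continuous_quot_mk.comp
    (continuous_subtype_val.subtype_mk _))
  have hs : Function.Surjective f := by
    intro p
    obtain ⟨w, hN, rfl⟩ := exists_rep p
    exact ⟨⟨w.1, hN⟩, rfl⟩
  exact hs.compactSpace hf

instance compact_CP2 : CompactSpace CP2 := by
  let K : Set (Fin 3 → ℂ) := Metric.sphere 0 1
  have : CompactSpace K := isCompact_iff_compactSpace.mp (isCompact_sphere 0 1)
  have hne : ∀ w : K, w.1 ≠ 0 := by
    rintro ⟨w, hw⟩ h
    simp only at h
    subst h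
    simp [K] at hw
  let f : K → CP2 := fun w => Quot.mk _ ⟨w.1, hne w⟩
  have hf : Continuous f := continuous_quot_mk.comp (continuous_subtype_val.subtype_mk _)
  have hs : Function.Surjective f := by
    rintro ⟨c⟩
    have hc : ‖c.1‖ ≠ 0 := norm_ne_zero_iff.mpr c.2
    have hr : ((‖c.1‖⁻¹ : ℝ) : ℂ) ≠ 0 := by exact_mod_cast inv_ne_zero hc
    refine ⟨⟨((‖c.1‖⁻¹ : ℝ) : ℂ) • c.1, ?_⟩, ?_⟩
    · simp only [K, mem_sphere_zero_iff_norm, norm_smul, norm_real, norm_inv, norm_norm]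
      exact inv_mul_cancel₀ hc
    · exact (Quot.sound ⟨_, hr, rfl⟩).symm
  exact hs.compactSpace hf

instance compact_hyper : CompactSpace ↥hypersimplex := by
  apply isCompact_iff_compactSpace.mp
  refine IsCompact.of_isClosed_subset (isCompact_Icc (a := (0 : Fin 4 → ℝ)) (b := 1)) ?_ ?_
  · unfold hypersimplex
    simp only [Set.ofPred_and, Set.ofPred_forall]
    refine IsClosed.inter (isClosed_iInter fun i => IsClosed.inter ?_ ?_) ?_
    · exact isClosed_le continuous_const (continuous_apply i)
    · exact isClosed_le (continuous_apply i) continuous_const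
    · exact isClosed_eq (by fun_prop) continuous_const
  · intro x hx
    exact ⟨fun i => (hx.1 i).1, fun i => (hx.1 i).2⟩

end CP5Proof

/-- the orbit space `ℂP⁵/T⁴` is homeomorphic to `(Δ₄,₂ × ℂP²)/≈`, where `≈`
collapses the `ℂP²`-factor over each boundary point of the octahedron `Δ₄,₂`. -/
theorem CP5_orbitSpace_homeomorph_glued_product :
    Nonempty (Quot orbitRel ≃ₜ Quot glueRel) := by
  exact CP5Proof.homeo_of_embed CP5Proof.Fbar CP5Proof.Gbar CP5Proof.continuous_Fbar
    CP5Proof.continuous_Gbar CP5Proof.Fbar_inj CP5Proof.Gbar_inj CP5Proof.range_eq
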